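/- If f has five distinct zeros θ₁, …, θ₅ in [0, π], then P has five distinct real roots, namely tₖ = u·cos θₖ for k = 1, …, 5, and all of them lie in the closed interval [−u, u]. In particular, all five roots of the quintic P are real. (Theorem 5 of the paper, the five-real-roots case.) -/

import Mathlib

/-- A complex root of a real monic depressed quintic with five distinct real roots is real. -/
lemma depressed_quintic_root_im_eq_zero {m n p q : ℝ} {t : Fin 5 → ℝ}
    (ht : Function.Injective t)
    (hroot : ∀ k, t k ^ 5 + m * t k ^ 3 + n * t k ^ 2 + p * t k + q = 0)
    {z : ℂ} (hz : z ^ 5 + (m : ℂ) * z ^ 3 + (n : ℂ) * z ^ 2 + (p : ℂ) * z + (q : ℂ) = 0) :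
    z.im = 0 := by
  by_contra him
  let Q : Polynomial ℂ := .X ^ 5 + .C (m : ℂ) * .X ^ 3 + .C (n : ℂ) * .X ^ 2
    + .C (p : ℂ) * .X + .C (q : ℂ)
  have hdeg : Q.natDegree = 5 := by
    simp only [Q]
    compute_degree!
  have hinj : Function.Injective (Fin.cons z fun k => (t k : ℂ) : Fin 6 → ℂ) := by
    refine Fin.cons_injective_iff.2 ⟨?_, Complex.ofReal_injective.comp ht⟩
    rintro ⟨k, rfl⟩
    exact him (Complex.ofReal_im _)
  have hQ : Q = 0 := by
    refine Polynomial.eq_zero_of_natDegree_lt_card_of_eval_eq_zero Q hinj ?_ (by simp [hdeg])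
    refine Fin.cases ?_ fun k => ?_
    · simpa [Q] using hz
    · simpa [Q] using congrArg Complex.ofReal (hroot k)
  simp [hQ] at hdeg

lemma cos_five_mul (x : ℝ) :
    Real.cos (5 * x) = 16 * Real.cos x ^ 5 - 20 * Real.cos x ^ 3 + 5 * Real.cos x := by
  rw [show 5 * x = 2 * x + 3 * x by ring, Real.cos_add, Real.cos_two_mul, Real.cos_three_mul,
    Real.sin_two_mul, Real.sin_three_mul]
  linear_combination (6 * Real.cos x
    - 8 * Real.cos x * (Real.sin x ^ 2 + 1 - Real.cos x ^ 2)) * (-Real.sin_sq_add_cos_sq x)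


/-- Theorem 5 (five real roots): if f has five distinct zeros θ₁,…,θ₅ in [0, π], then
the tₖ = u·cos θₖ are five distinct real roots of P, all lying in [−u, u]; in
particular every complex root of the quintic is real. -/
theorem quintic_five_real_roots (m n p q : ℝ) (hm : m < 0)
    (P : ℝ → ℝ) (hP : ∀ t, P t = t^5 + m*t^3 + n*t^2 + p*t + q)
    (u : ℝ) (hu : u = 2 * Real.sqrt (-m) / Real.sqrt 5)
    (α β γ : ℝ) (hα : α = 16*n/u^3) (hβ : β = 16*p/u^4 - 5) (hγ : γ = 16*q/u^5)
    (f : ℝ → ℝ)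
    (hf : ∀ θ, f θ = α * Real.cos θ ^ 2 + β * Real.cos θ + Real.cos (5*θ) + γ)
    (θ : Fin 5 → ℝ) (hθmem : ∀ k, θ k ∈ Set.Icc (0:ℝ) Real.pi)
    (hθinj : Function.Injective θ) (hθzero : ∀ k, f (θ k) = 0) :
    Function.Injective (fun k : Fin 5 => u * Real.cos (θ k)) ∧
    (∀ k : Fin 5, P (u * Real.cos (θ k)) = 0) ∧
    (∀ k : Fin 5, u * Real.cos (θ k) ∈ Set.Icc (-u) u) ∧
    (∀ z : ℂ, z^5 + (m:ℂ)*z^3 + (n:ℂ)*z^2 + (p:ℂ)*z + (q:ℂ) = 0 → z.im = 0) := by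
  have hu0 : 0 < u := by
    rw [hu]
    have : 0 < -m := neg_pos.2 hm
    positivity
  have hm' : m = -5 / 4 * u ^ 2 := by
    rw [hu, div_pow, mul_pow, Real.sq_sqrt (neg_pos.2 hm).le, Real.sq_sqrt (by norm_num)]
    ring
  have hinj : Function.Injective fun k : Fin 5 => u * Real.cos (θ k) := fun i j hij =>
    hθinj (Real.injOn_cos (hθmem i) (hθmem j) (mul_left_cancel₀ hu0.ne' hij))
  have hscale : ∀ x, P (u * Real.cos x) = u ^ 5 / 16 * f x := by
    intro x
    rw [hP, hf, cos_five_mul, hα, hβ, hγ, hm']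
    field_simp
    ring
  have hroot : ∀ k, P (u * Real.cos (θ k)) = 0 := fun k => by rw [hscale, hθzero, mul_zero]
  refine ⟨hinj, hroot, fun k => ⟨?_, ?_⟩, fun z hz => ?_⟩
  · nlinarith [Real.neg_one_le_cos (θ k)]
  · nlinarith [Real.cos_le_one (θ k)]
  · exact depressed_quintic_root_im_eq_zero hinj (fun k => hP _ ▸ hroot k) hz
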